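/- Let g be a finite-dimensional semisimple Lie algebra over an algebraically closed field F of characteristic 0, let h be a Cartan subalgebra of g, and suppose A : g × g → g is a bilinear product satisfying (PR1): A u v − A v u = ⁅u, v⁆ for all u, v ∈ g, and (PR3): ⁅A u v, w⁆ + ⁅u, A w v⁆ = 0 for all u, v, w ∈ g. Then h is closed under the product A: for all h₁, h₂ ∈ h, A h₁ h₂ ∈ h. -/

import Mathlib

/-- A map `f` on a Lie algebra with nondegenerate Killing form satisfying `⁅f u, w⁆ + ⁅u, f w⁆ = 0`
vanishes: the form `κ(f u, ⁅w, x⁆)` is symmetric in `u, w` and antisymmetric in `w, x`. -/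
theorem LieAlgebra.IsKilling.eq_zero_of_lie_apply_add_lie_apply_eq_zero
    {K L : Type*} [Field K] [CharZero K] [LieRing L] [LieAlgebra K L] [FiniteDimensional K L]
    [LieAlgebra.IsKilling K L] (f : L → L) (hf : ∀ u w : L, ⁅f u, w⁆ + ⁅u, f w⁆ = 0) (u : L) :
    f u = 0 := by
  have hsymm (u w x : L) : killingForm K L ⁅f u, w⁆ x = killingForm K L ⁅f w, u⁆ x := by
    rw [eq_neg_of_add_eq_zero_left (hf u w), lie_skew]
  have hanti (u w x : L) : killingForm K L ⁅f u, w⁆ x = -killingForm K L ⁅f u, x⁆ w := by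
    rw [LieModule.traceForm_apply_lie_apply, LieModule.traceForm_apply_lie_apply, ← lie_skew w x,
      map_neg]
  have hzero (u w x : L) : killingForm K L ⁅f u, w⁆ x = 0 := by
    rw [← self_eq_neg]
    calc killingForm K L ⁅f u, w⁆ x = -killingForm K L ⁅f w, x⁆ u := by rw [hsymm, hanti]
      _ = killingForm K L ⁅f x, u⁆ w := by rw [hsymm, hanti, neg_neg]
      _ = -killingForm K L ⁅f u, w⁆ x := by rw [hsymm, hanti]
  have hlie (w : L) : ⁅f u, w⁆ = 0 :=
    LinearMap.ker_eq_bot'.mp (LieAlgebra.IsKilling.ker_killingForm_eq_bot K L) _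
      (LinearMap.ext (hzero u w))
  refine LinearMap.ker_eq_bot'.mp (LieAlgebra.IsKilling.ker_killingForm_eq_bot K L) _ ?_
  ext x
  rw [killingForm_apply_apply, show LieAlgebra.ad K L (f u) = 0 from LinearMap.ext hlie]
  simp

/-- If a finite-dimensional semisimple Lie algebra over an algebraically closed field of
characteristic 0 carries a bilinear product `A` satisfying (PR1) and (PR3), then any
Cartan subalgebra is closed under the product `A`. -/
theorem cartan_closed_under_product
    {F : Type*} [Field F] [IsAlgClosed F] [CharZero F]
    {g : Type*} [LieRing g] [LieAlgebra F g] [FiniteDimensional F g]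
    [LieAlgebra.IsSemisimple F g]
    (H : LieSubalgebra F g) (hH : H.IsCartanSubalgebra)
    (A : g →ₗ[F] g →ₗ[F] g)
    (PR1 : ∀ u v : g, A u v - A v u = ⁅u, v⁆)
    (PR3 : ∀ u v w : g, ⁅A u v, w⁆ + ⁅u, A w v⁆ = 0) :
    ∀ h₁ ∈ H, ∀ h₂ ∈ H, A h₁ h₂ ∈ H := by
  intro u _ v _
  rw [LieAlgebra.IsKilling.eq_zero_of_lie_apply_add_lie_apply_eq_zero (K := F) (fun u ↦ A u v)
    (fun u w ↦ PR3 u v w) u]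
  exact H.zero_mem
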